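/- arXiv:2504.15515 — 8 statements merged into one kernel-verified Lean document; each statement's English description precedes it below -/
import Mathlib

section
/- Let p, q be smooth positive probability densities on ℝ with quantile functions Q_p = F_p^{-1}, Q_q = F_q^{-1}, let T be the monotone map with T_#q = p, and let f: ℝ → ℝ₊ be convex with f(1)=0. Then the transport f-divergence equals the quantile-density formulation: D_{T,f}(p‖q) = ∫_0^1 f( Q_p'(u) / Q_q'(u) ) du, where Q_p'(u) = (d/du)Q_p(u) and Q_q'(u) = (d/du)Q_q(u) are the quantile density functions. -/
open MeasureTheory

section CumulativeDistribution

variable {p F Q : ℝ → ℝ}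

lemma integral_Iio_hasDerivAt (hp : Continuous p) (hint : Integrable p)
    (hF : ∀ x, F x = ∫ y in Set.Iio x, p y) (x : ℝ) : HasDerivAt F (p x) x := by
  have h : F = fun x => F 0 + ∫ y in (0 : ℝ)..x, p y := by
    funext x
    rw [← intervalIntegral.integral_Iic_sub_Iic hint.integrableOn hint.integrableOn,
      hF, hF, ← integral_Iic_eq_integral_Iio, ← integral_Iic_eq_integral_Iio]
    ring
  rw [h]
  exact (intervalIntegral.integral_hasDerivAt_right (hp.intervalIntegrable _ _)
    (hp.stronglyMeasurableAtFilter _ _) hp.continuousAt).const_add _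

lemma integral_Iio_strictMono (hpos : ∀ x, 0 < p x)
    (hderiv : ∀ x, HasDerivAt F (p x) x) : StrictMono F :=
  strictMono_of_deriv_pos fun x => by rw [(hderiv x).deriv]; exact hpos x

lemma integral_Iio_mem_Ioo (hpos : ∀ x, 0 < p x) (hint : Integrable p)
    (hprob : ∫ x, p x = 1) (hF : ∀ x, F x = ∫ y in Set.Iio x, p y)
    (hmono : StrictMono F) (x : ℝ) : F x ∈ Set.Ioo (0 : ℝ) 1 := by
  have h0 : 0 ≤ F (x - 1) := by
    rw [hF]
    exact integral_nonneg fun y => (hpos y).le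
  have h1 : F (x + 1) ≤ 1 := by
    rw [hF, ← hprob]
    exact setIntegral_le_integral hint (Filter.Eventually.of_forall fun y => (hpos y).le)
  exact ⟨h0.trans_lt (hmono (by linarith)), (hmono (by linarith)).trans_le h1⟩

lemma quantile_hasDerivAt (hpos : ∀ x, 0 < p x)
    (hderiv : ∀ x, HasDerivAt F (p x) x) (hmem : ∀ x, F x ∈ Set.Ioo (0 : ℝ) 1)
    (hleft : ∀ x, Q (F x) = x) (hright : ∀ u ∈ Set.Ioo (0 : ℝ) 1, F (Q u) = u) (x : ℝ) :
    HasDerivAt Q (p x)⁻¹ (F x) := by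
  have hnhds : Set.Ioo (0 : ℝ) 1 ∈ nhds (F x) := Ioo_mem_nhds (hmem x).1 (hmem x).2
  have hmono : StrictMonoOn Q (Set.Ioo (0 : ℝ) 1) := fun u hu v hv huv => by
    rw [← (integral_Iio_strictMono hpos hderiv).lt_iff_lt, hright u hu, hright v hv]
    exact huv
  have himage : Q '' Set.Ioo (0 : ℝ) 1 = Set.univ :=
    Set.eq_univ_of_forall fun y => ⟨F y, hmem y, hleft y⟩
  have hcont : ContinuousAt Q (F x) :=
    hmono.continuousAt_of_image_mem_nhds hnhds (by rw [himage]; exact Filter.univ_mem)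
  refine HasDerivAt.of_local_left_inverse (f := F) hcont ?_ (hpos x).ne'
    (Filter.eventually_of_mem hnhds hright)
  rw [hleft]
  exact hderiv x

end CumulativeDistribution

/-- Two functions with range `(0, 1)` and the same derivative are equal. -/
lemma eq_of_hasDerivAt_of_surjOn_Ioo {G H d : ℝ → ℝ}
    (hG : ∀ x, HasDerivAt G (d x) x) (hH : ∀ x, HasDerivAt H (d x) x)
    (hGmem : ∀ x, G x ∈ Set.Ioo (0 : ℝ) 1) (hHmem : ∀ x, H x ∈ Set.Ioo (0 : ℝ) 1)
    (hHsurj : ∀ u ∈ Set.Ioo (0 : ℝ) 1, ∃ x, H x = u) (x : ℝ) : G x = H x := by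
  have hconst : ∀ y, G y - H y = G x - H x := fun y =>
    is_const_of_deriv_eq_zero (f := fun y => G y - H y)
      (fun y => ((hG y).sub (hH y)).differentiableAt)
      (fun y => ((hG y).sub (hH y)).deriv.trans (sub_self _)) y x
  obtain ⟨hG0, hG1⟩ := hGmem x
  obtain ⟨hH0, hH1⟩ := hHmem x
  rcases lt_trichotomy (G x) (H x) with h | h | h
  · obtain ⟨y, hy⟩ := hHsurj ((H x - G x) / 2) ⟨by linarith, by linarith⟩
    linarith [hconst y, (hGmem y).1]
  · exact h
  · obtain ⟨y, hy⟩ := hHsurj (1 - (G x - H x) / 2) ⟨by linarith, by linarith⟩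
    linarith [hconst y, (hGmem y).2]

/-- Quantile-density formulation of the transport f-divergence:
`D_{T,f}(p‖q) = ∫_0^1 f(Q_p'(u)/Q_q'(u)) du`. -/
theorem transport_f_divergence_quantile_formulation
    (p q : ℝ → ℝ)
    (hp_pos : ∀ x, 0 < p x) (hq_pos : ∀ x, 0 < q x)
    (hp_smooth : ContDiff ℝ (⊤ : ℕ∞) p) (hq_smooth : ContDiff ℝ (⊤ : ℕ∞) q)
    (hp_prob : ∫ x, p x = 1) (hq_prob : ∫ x, q x = 1)
    (Fp Fq : ℝ → ℝ)
    (hFp : ∀ x, Fp x = ∫ y in Set.Iio x, p y)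
    (hFq : ∀ x, Fq x = ∫ y in Set.Iio x, q y)
    (Qp Qq : ℝ → ℝ)
    (hQp_left : ∀ x, Qp (Fp x) = x)
    (hQp_right : ∀ u ∈ Set.Ioo (0 : ℝ) 1, Fp (Qp u) = u)
    (hQq_left : ∀ x, Qq (Fq x) = x)
    (hQq_right : ∀ u ∈ Set.Ioo (0 : ℝ) 1, Fq (Qq u) = u)
    (f : ℝ → ℝ)
    (hf_conv : ConvexOn ℝ Set.univ f)
    (hf_nonneg : ∀ u, 0 ≤ f u)
    (hf_one : f 1 = 0)
    (T : ℝ → ℝ)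
    (hT_mono : StrictMono T)
    (hT_diff : Differentiable ℝ T)
    (hT_surj : Function.Surjective T)
    (hT_push : ∀ x, p (T x) * deriv T x = q x) :
    ∫ x, f (q x / p (T x)) * q x
      = ∫ u in Set.Ioo (0 : ℝ) 1, f (deriv Qp u / deriv Qq u) := by
  have hp_int : Integrable p := .of_integral_ne_zero (by simp [hp_prob])
  have hq_int : Integrable q := .of_integral_ne_zero (by simp [hq_prob])
  have hFp_deriv := integral_Iio_hasDerivAt hp_smooth.continuous hp_int hFp
  have hFq_deriv := integral_Iio_hasDerivAt hq_smooth.continuous hq_int hFq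
  have hFq_mono := integral_Iio_strictMono hq_pos hFq_deriv
  have hFp_mem := integral_Iio_mem_Ioo hp_pos hp_int hp_prob hFp
    (integral_Iio_strictMono hp_pos hFp_deriv)
  have hFq_mem := integral_Iio_mem_Ioo hq_pos hq_int hq_prob hFq hFq_mono
  have hFT : ∀ x, Fp (T x) = Fq x :=
    eq_of_hasDerivAt_of_surjOn_Ioo (G := fun x => Fp (T x)) (d := q)
      (fun x => by
        rw [← hT_push x]
        exact (hFp_deriv (T x)).comp x (hT_diff x).hasDerivAt)
      hFq_deriv (fun x => hFp_mem (T x)) hFq_mem fun u hu => ⟨Qq u, hQq_right u hu⟩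
  have himage : Fq '' Set.univ = Set.Ioo (0 : ℝ) 1 := by
    refine Set.Subset.antisymm ?_ fun u hu => ⟨Qq u, trivial, hQq_right u hu⟩
    rintro _ ⟨x, -, rfl⟩
    exact hFq_mem x
  rw [← himage, integral_image_eq_integral_abs_deriv_smul MeasurableSet.univ
    (fun x _ => (hFq_deriv x).hasDerivWithinAt) hFq_mono.injective.injOn, setIntegral_univ]
  congr 1
  funext x
  have hQp' := quantile_hasDerivAt hp_pos hFp_deriv hFp_mem hQp_left hQp_right (T x)
  rw [hFT] at hQp'
  rw [hQp'.deriv,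
    (quantile_hasDerivAt hq_pos hFq_deriv hFq_mem hQq_left hQq_right x).deriv,
    abs_of_pos (hq_pos x), smul_eq_mul, inv_div_inv, mul_comm]
end

section
/- Let p, q, p_ref be smooth positive probability densities on ℝ, let T_p, T_q: ℝ → ℝ be the monotone maps with (T_p)_# p_ref = p and (T_q)_# p_ref = q, let T be the monotone map with T_#q = p, and let f: ℝ → ℝ₊ be convex with f(1)=0. Then the transport f-divergence satisfies D_{T,f}(p‖q) = ∫_ℝ f( T_p'(z) / T_q'(z) ) p_ref(z) dz. -/
open MeasureTheory

lemma deriv_eq_div_of_pushforward {μ ν S : ℝ → ℝ} (hν : ∀ x, 0 < ν x)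
    (hpush : ∀ z, ν (S z) * deriv S z = μ z) (z : ℝ) : deriv S z = μ z / ν (S z) := by
  rw [eq_div_iff (hν _).ne', mul_comm, hpush]

lemma setIntegral_image_eq_of_pushforward {μ ν S : ℝ → ℝ} (hμ : ∀ x, 0 < μ x)
    (hν : ∀ x, 0 < ν x) (hS : StrictMono S) (hdiff : Differentiable ℝ S)
    (hpush : ∀ z, ν (S z) * deriv S z = μ z) (g : ℝ → ℝ) {s : Set ℝ} (hs : MeasurableSet s) :
    ∫ x in S '' s, g x * ν x = ∫ z in s, g (S z) * μ z := by
  rw [integral_image_eq_integral_abs_deriv_smul hs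
    (fun x _ => (hdiff x).hasDerivAt.hasDerivWithinAt) hS.injective.injOn]
  refine integral_congr_ae (Filter.Eventually.of_forall fun z => ?_)
  have hderiv : 0 < deriv S z := by
    rw [deriv_eq_div_of_pushforward hν hpush]
    exact div_pos (hμ z) (hν _)
  simp only [smul_eq_mul, abs_of_pos hderiv, ← hpush z]
  ring

lemma setIntegral_Iic_eq_of_pushforward {μ ν S : ℝ → ℝ} (hμ : ∀ x, 0 < μ x)
    (hν : ∀ x, 0 < ν x) (hS : StrictMono S) (hdiff : Differentiable ℝ S)
    (hsurj : Function.Surjective S) (hpush : ∀ z, ν (S z) * deriv S z = μ z) (z : ℝ) :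
    ∫ x in Set.Iic (S z), ν x = ∫ x in Set.Iic z, μ x := by
  have himage : S '' Set.Iic z = Set.Iic (S z) := (hS.orderIsoOfSurjective S hsurj).image_Iic z
  simpa [himage] using
    setIntegral_image_eq_of_pushforward hμ hν hS hdiff hpush (fun _ => 1) (measurableSet_Iic (a := z))

lemma strictMono_setIntegral_Iic {p : ℝ → ℝ} (hpos : ∀ x, 0 < p x) (hint : Integrable p) :
    StrictMono fun a => ∫ x in Set.Iic a, p x := by
  intro a b hab
  have hpos_interval : 0 < ∫ x in a..b, p x :=
    intervalIntegral.intervalIntegral_pos_of_pos hint.intervalIntegrable hpos hab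
  rw [← intervalIntegral.integral_Iic_sub_Iic hint.integrableOn hint.integrableOn] at hpos_interval
  exact sub_pos.mp hpos_interval

/-- Reference-measure formulation of the transport f-divergence:
if `(T_p)_# p_ref = p` and `(T_q)_# p_ref = q`, then
`D_{T,f}(p‖q) = ∫ f(T_p'(z)/T_q'(z)) p_ref(z) dz`. -/
theorem transport_f_divergence_reference_formulation
    (p q pref : ℝ → ℝ)
    (hp_pos : ∀ x, 0 < p x) (hq_pos : ∀ x, 0 < q x) (href_pos : ∀ x, 0 < pref x)
    (hp_smooth : ContDiff ℝ (⊤ : ℕ∞) p) (hq_smooth : ContDiff ℝ (⊤ : ℕ∞) q)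
    (href_smooth : ContDiff ℝ (⊤ : ℕ∞) pref)
    (hp_prob : ∫ x, p x = 1) (hq_prob : ∫ x, q x = 1) (href_prob : ∫ x, pref x = 1)
    (f : ℝ → ℝ)
    (hf_conv : ConvexOn ℝ Set.univ f)
    (hf_nonneg : ∀ u, 0 ≤ f u)
    (hf_one : f 1 = 0)
    (Tp Tq T : ℝ → ℝ)
    (hTp_mono : StrictMono Tp) (hTp_diff : Differentiable ℝ Tp)
    (hTp_surj : Function.Surjective Tp)
    (hTp_push : ∀ z, p (Tp z) * deriv Tp z = pref z)
    (hTq_mono : StrictMono Tq) (hTq_diff : Differentiable ℝ Tq)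
    (hTq_surj : Function.Surjective Tq)
    (hTq_push : ∀ z, q (Tq z) * deriv Tq z = pref z)
    (hT_mono : StrictMono T) (hT_diff : Differentiable ℝ T)
    (hT_surj : Function.Surjective T)
    (hT_push : ∀ x, p (T x) * deriv T x = q x) :
    ∫ x, f (q x / p (T x)) * q x
      = ∫ z, f (deriv Tp z / deriv Tq z) * pref z := by
  have hp_int : Integrable p := by
    by_contra h
    simp [integral_undef h] at hp_prob
  have hcomp : ∀ z, T (Tq z) = Tp z := fun z =>
    (strictMono_setIntegral_Iic hp_pos hp_int).injective <| by
      simp only [setIntegral_Iic_eq_of_pushforward hq_pos hp_pos hT_mono hT_diff hT_surj hT_push,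
        setIntegral_Iic_eq_of_pushforward href_pos hq_pos hTq_mono hTq_diff hTq_surj hTq_push,
        setIntegral_Iic_eq_of_pushforward href_pos hp_pos hTp_mono hTp_diff hTp_surj hTp_push]
  have hratio : ∀ z, deriv Tp z / deriv Tq z = q (Tq z) / p (T (Tq z)) := fun z => by
    rw [hcomp, deriv_eq_div_of_pushforward hp_pos hTp_push,
      deriv_eq_div_of_pushforward hq_pos hTq_push]
    have := (href_pos z).ne'
    have := (hp_pos (Tp z)).ne'
    have := (hq_pos (Tq z)).ne'
    field_simp
  simp_rw [hratio]
  simpa [hTq_surj.range_eq] using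
    setIntegral_image_eq_of_pushforward href_pos hq_pos hTq_mono hTq_diff hTq_push
      (fun x => f (q x / p (T x))) MeasurableSet.univ
end

section
/- Let Ω = [0,1], let q ≡ 1 be the uniform density on [0,1], let p be a smooth positive probability density on [0,1], let T be the monotone map with T_#q = p, and let f: ℝ → ℝ₊ be convex with f(1)=0. Then the transport f-divergence equals the generalized negative entropy: D_{T,f}(p‖1) = ∫_Ω f(1/p(x)) p(x) dx. -/
open MeasureTheory

/-- On `Ω = [0,1]` with `q ≡ 1` the uniform density, the transport
f-divergence equals the generalized negative entropy:
`D_{T,f}(p‖1) = ∫_Ω f(1/p(x)) p(x) dx`. -/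
theorem transport_f_divergence_entropy
    (p : ℝ → ℝ)
    (hp_pos : ∀ x ∈ Set.Icc (0 : ℝ) 1, 0 < p x)
    (hp_smooth : ContDiffOn ℝ (⊤ : ℕ∞) p (Set.Icc 0 1))
    (hp_prob : ∫ x in Set.Icc (0 : ℝ) 1, p x = 1)
    (f : ℝ → ℝ)
    (hf_conv : ConvexOn ℝ Set.univ f)
    (hf_nonneg : ∀ u, 0 ≤ f u)
    (hf_one : f 1 = 0)
    (T : ℝ → ℝ)
    (hT_mono : StrictMonoOn T (Set.Icc 0 1))
    (hT_diff : Differentiable ℝ T)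
    (hT_maps : Set.MapsTo T (Set.Icc 0 1) (Set.Icc 0 1))
    (hT_zero : T 0 = 0) (hT_one : T 1 = 1)
    (hT_push : ∀ x ∈ Set.Icc (0 : ℝ) 1, p (T x) * deriv T x = 1) :
    ∫ x in Set.Icc (0 : ℝ) 1, f (1 / p (T x))
      = ∫ x in Set.Icc (0 : ℝ) 1, f (1 / p x) * p x := by
  have himage : T '' Set.Icc 0 1 = Set.Icc 0 1 := by
    refine hT_maps.image_subset.antisymm ?_
    simpa only [hT_zero, hT_one] using
      intermediate_value_Icc zero_le_one hT_diff.continuous.continuousOn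
  have hchange := integral_image_eq_integral_abs_deriv_smul measurableSet_Icc
    (fun x _ => (hT_diff x).hasDerivAt.hasDerivWithinAt) hT_mono.injOn
    (fun y => f (1 / p y) * p y)
  rw [himage] at hchange
  rw [hchange]
  refine setIntegral_congr_fun measurableSet_Icc fun x hx => ?_
  have hderiv : 0 < deriv T x :=
    pos_of_mul_pos_right (by rw [hT_push x hx]; exact one_pos) (hp_pos _ (hT_maps hx)).le
  calc f (1 / p (T x)) = f (1 / p (T x)) * (p (T x) * deriv T x) := by rw [hT_push x hx, mul_one]
    _ = |deriv T x| • (f (1 / p (T x)) * p (T x)) := by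
      rw [abs_of_pos hderiv, smul_eq_mul]; ring
end

section
/- Let p, q be smooth positive probability densities on ℝ, and let f: (0,∞) → ℝ₊ be convex with f(1)=0. Define f̂(u) := f(1/u) for u > 0. Then the transport f-divergence satisfies the duality D_{T,f}(p‖q) = D_{T,f̂}(q‖p), where on the left T is the monotone map with T_#q = p and on the right the monotone map pushing p to q is used. -/
open MeasureTheory

/-- Duality of the transport f-divergence:
`D_{T,f}(p‖q) = D_{T,f̂}(q‖p)` with `f̂(u) = f(1/u)`, where `T_#q = p` on the left
and `S_#p = q` (the inverse monotone map) on the right. -/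
theorem transport_f_divergence_duality
    (p q : ℝ → ℝ)
    (hp_pos : ∀ x, 0 < p x) (hq_pos : ∀ x, 0 < q x)
    (hp_smooth : ContDiff ℝ (⊤ : ℕ∞) p) (hq_smooth : ContDiff ℝ (⊤ : ℕ∞) q)
    (hp_prob : ∫ x, p x = 1) (hq_prob : ∫ x, q x = 1)
    (f : ℝ → ℝ)
    (hf_conv : ConvexOn ℝ (Set.Ioi 0) f)
    (hf_nonneg : ∀ u ∈ Set.Ioi (0 : ℝ), 0 ≤ f u)
    (hf_one : f 1 = 0)
    (T S : ℝ → ℝ)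
    (hT_mono : StrictMono T) (hT_diff : Differentiable ℝ T)
    (hT_surj : Function.Surjective T)
    (hT_push : ∀ x, p (T x) * deriv T x = q x)
    (hS_mono : StrictMono S) (hS_diff : Differentiable ℝ S)
    (hS_surj : Function.Surjective S)
    (hS_push : ∀ x, q (S x) * deriv S x = p x)
    (hS_left : Function.LeftInverse S T)
    (hS_right : Function.RightInverse S T) :
    ∫ x, f (deriv T x) * q x = ∫ x, f (1 / deriv S x) * p x := by
  have change_of_variables := integral_image_eq_integral_abs_deriv_smul MeasurableSet.univ
    (fun x _ => (hT_diff x).hasDerivAt.hasDerivWithinAt) hT_mono.injective.injOn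
    (fun x => f (1 / deriv S x) * p x)
  rw [Set.image_univ, hT_surj.range_eq, setIntegral_univ, setIntegral_univ] at change_of_variables
  rw [change_of_variables]
  refine integral_congr_ae (.of_forall fun x => ?_)
  have hS := hS_push (T x)
  rw [hS_left x] at hS
  have hdT : deriv T x = q x / p (T x) := by
    rw [eq_div_iff (hp_pos _).ne', mul_comm, hT_push]
  have hdS : deriv S (T x) = p (T x) / q x := by
    rw [eq_div_iff (hq_pos _).ne', mul_comm, hS]
  have hdT_pos : 0 < deriv T x := hdT ▸ div_pos (hq_pos x) (hp_pos _)
  simp only [smul_eq_mul]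
  rw [abs_of_pos hdT_pos, hdS, one_div_div, ← hdT, ← hT_push x]
  ring
end

section
/- Let p, q be smooth positive probability densities on ℝ, let T be the monotone map with T_#q = p, and let f: ℝ → ℝ₊ be convex with f(1)=0. Let k: ℝ → ℝ be a smooth bijective (monotone increasing) map with inverse k^{-1}. Define q̃ = (k^{-1})_# q, define T̃(x) = ∫_0^x T'(k(y)) dy + c for a constant c ∈ ℝ, and set p̃ = T̃_# q̃. Then D_{T,f}(p̃‖q̃) = D_{T,f}(p‖q), i.e. the transport f-divergence is invariant under this transformation. -/
open MeasureTheory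

/-- Transport invariance of the transport f-divergence: with
`q̃ = (k⁻¹)_# q`, `T̃(x) = ∫_0^x T'(k(y)) dy + c` and `p̃ = T̃_# q̃`, one has
`D_{T,f}(p̃‖q̃) = D_{T,f}(p‖q)`. -/
theorem transport_f_divergence_transport_invariance
    (p q : ℝ → ℝ)
    (hp_pos : ∀ x, 0 < p x) (hq_pos : ∀ x, 0 < q x)
    (hp_smooth : ContDiff ℝ (⊤ : ℕ∞) p) (hq_smooth : ContDiff ℝ (⊤ : ℕ∞) q)
    (hp_prob : ∫ x, p x = 1) (hq_prob : ∫ x, q x = 1)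
    (f : ℝ → ℝ)
    (hf_conv : ConvexOn ℝ Set.univ f)
    (hf_nonneg : ∀ u, 0 ≤ f u)
    (hf_one : f 1 = 0)
    (T : ℝ → ℝ)
    (hT_mono : StrictMono T) (hT_diff : Differentiable ℝ T)
    (hT_push : ∀ x, p (T x) * deriv T x = q x)
    (k kinv : ℝ → ℝ)
    (hk_smooth : ContDiff ℝ (⊤ : ℕ∞) k)
    (hk_mono : StrictMono k)
    (hk_left : Function.LeftInverse kinv k)
    (hk_right : Function.RightInverse kinv k)
    (qt : ℝ → ℝ)
    (hqt_push : ∀ x, qt (kinv x) * deriv kinv x = q x)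
    (c : ℝ)
    (Tt : ℝ → ℝ)
    (hTt : ∀ x, Tt x = (∫ y in (0 : ℝ)..x, deriv T (k y)) + c)
    (pt : ℝ → ℝ)
    (hpt_push : ∀ x, pt (Tt x) * deriv Tt x = qt x) :
    ∫ x, f (deriv Tt x) * qt x = ∫ x, f (deriv T x) * q x := by
  have hT_cont : Continuous (deriv T) := by
    have h : deriv T = fun x => q x / p (T x) := by
      funext x
      rw [eq_div_iff (hp_pos _).ne', mul_comm]
      exact hT_push x
    rw [h]
    exact hq_smooth.continuous.div (hp_smooth.continuous.comp hT_diff.continuous)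
      fun x => (hp_pos _).ne'
  have hTt_deriv : ∀ x, deriv Tt x = deriv T (k x) := by
    intro x
    rw [funext hTt, deriv_add_const]
    exact (hT_cont.comp hk_smooth.continuous).deriv_integral _ 0 x
  have hkinv_mono : Monotone kinv := fun x y hxy => by
    rw [← hk_mono.le_iff_le, hk_right x, hk_right y]
    exact hxy
  have hkinv_deriv : ∀ x, HasDerivAt kinv (deriv kinv x) x := fun x =>
    (differentiableAt_of_deriv_ne_zero fun h => (hq_pos x).ne' <| by
      rw [← hqt_push x, h, mul_zero]).hasDerivAt
  have hcv := integral_image_eq_integral_abs_deriv_smul MeasurableSet.univ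
    (fun x _ => (hkinv_deriv x).hasDerivWithinAt) hk_right.injective.injOn
    (fun x => f (deriv Tt x) * qt x)
  rw [Set.image_univ, hk_left.surjective.range_eq, setIntegral_univ, setIntegral_univ] at hcv
  rw [hcv]
  congr 1
  funext x
  rw [abs_of_nonneg hkinv_mono.deriv_nonneg, hTt_deriv, hk_right x, ← hqt_push x, smul_eq_mul]
  ring
end

section
/- Let q be a smooth positive probability density on ℝ, let T₁, T₂: ℝ → ℝ be monotone increasing maps, and set p₁ = (T₁)_#q, p₂ = (T₂)_#q, and for λ ∈ [0,1], p_λ = (λ T₁ + (1−λ) T₂)_# q. Let f: ℝ → ℝ₊ be convex with f(1)=0. Then the transport f-divergence is convex along this interpolation: D_{T,f}(p_λ‖q) ≤ λ · D_{T,f}(p₁‖q) + (1−λ) · D_{T,f}(p₂‖q). -/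
open MeasureTheory

/-- Transport convexity in the first variable:
`D_{T,f}(p_λ‖q) ≤ λ D_{T,f}(p₁‖q) + (1−λ) D_{T,f}(p₂‖q)` along
`p_λ = (λT₁ + (1−λ)T₂)_# q`. -/
theorem transport_f_divergence_convexity
    (q : ℝ → ℝ)
    (hq_pos : ∀ x, 0 < q x)
    (hq_smooth : ContDiff ℝ (⊤ : ℕ∞) q)
    (hq_prob : ∫ x, q x = 1)
    (T₁ T₂ : ℝ → ℝ)
    (hT₁_mono : StrictMono T₁) (hT₁_diff : Differentiable ℝ T₁)
    (hT₂_mono : StrictMono T₂) (hT₂_diff : Differentiable ℝ T₂)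
    (p₁ p₂ : ℝ → ℝ)
    (hp₁_push : ∀ x, p₁ (T₁ x) * deriv T₁ x = q x)
    (hp₂_push : ∀ x, p₂ (T₂ x) * deriv T₂ x = q x)
    (lam : ℝ) (hlam₀ : 0 ≤ lam) (hlam₁ : lam ≤ 1)
    (plam : ℝ → ℝ)
    (hplam_push : ∀ x,
      plam (lam * T₁ x + (1 - lam) * T₂ x)
        * deriv (fun y => lam * T₁ y + (1 - lam) * T₂ y) x = q x)
    (f : ℝ → ℝ)
    (hf_conv : ConvexOn ℝ Set.univ f)
    (hf_nonneg : ∀ u, 0 ≤ f u)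
    (hf_one : f 1 = 0)
    (hD₁_int : Integrable (fun x => f (deriv T₁ x) * q x))
    (hD₂_int : Integrable (fun x => f (deriv T₂ x) * q x)) :
    ∫ x, f (deriv (fun y => lam * T₁ y + (1 - lam) * T₂ y) x) * q x
      ≤ lam * (∫ x, f (deriv T₁ x) * q x)
        + (1 - lam) * ∫ x, f (deriv T₂ x) * q x := by
  have hderiv (x : ℝ) : deriv (fun y => lam * T₁ y + (1 - lam) * T₂ y) x
      = lam * deriv T₁ x + (1 - lam) * deriv T₂ x :=
    (((hT₁_diff x).hasDerivAt.const_mul lam).add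
      ((hT₂_diff x).hasDerivAt.const_mul (1 - lam))).deriv
  simp only [hderiv]
  rw [← integral_const_mul, ← integral_const_mul,
    ← integral_add (hD₁_int.const_mul lam) (hD₂_int.const_mul (1 - lam))]
  refine integral_mono_of_nonneg
    (ae_of_all _ fun x => mul_nonneg (hf_nonneg _) (hq_pos x).le)
    ((hD₁_int.const_mul lam).add (hD₂_int.const_mul (1 - lam)))
    (ae_of_all _ fun x => ?_)
  have hconv := hf_conv.2 (Set.mem_univ (deriv T₁ x)) (Set.mem_univ (deriv T₂ x))
    hlam₀ (sub_nonneg.2 hlam₁) (add_sub_cancel lam 1)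
  simp only [smul_eq_mul] at hconv
  calc f (lam * deriv T₁ x + (1 - lam) * deriv T₂ x) * q x
      ≤ (lam * f (deriv T₁ x) + (1 - lam) * f (deriv T₂ x)) * q x :=
        mul_le_mul_of_nonneg_right hconv (hq_pos x).le
    _ = lam * (f (deriv T₁ x) * q x) + (1 - lam) * (f (deriv T₂ x) * q x) := by ring
end

section
/- Let p, q be smooth positive probability densities on ℝ, let T be the monotone map with T_#q = p, and let f ∈ C² with f(1) = f'(1) = 0 and f convex nonnegative. For λ ∈ [0,1], let p_λ = ((1−λ)·id + λ·T)_# q be the Wasserstein-2 geodesic from q to p, where id(x)=x. Then lim_{λ→0} (1/λ²) · D_{T,f}(p_λ‖q) = (f''(1)/2) · ∫_ℝ |T'(x) − 1|² q(x) dx. -/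
open MeasureTheory Filter

/-- Second-order Peano expansion of a `C²` function at a zero of order at least two. -/
theorem isLittleO_sub_half_iteratedDeriv_two {f : ℝ → ℝ} {a : ℝ} (hf : ContDiff ℝ 2 f)
    (h0 : f a = 0) (h1 : deriv f a = 0) :
    (fun u => f u - iteratedDeriv 2 f a / 2 * (u - a) ^ 2) =o[nhds a]
      fun u => (u - a) ^ 2 := by
  refine (taylor_isLittleO_univ (x₀ := a) (n := 2) hf).congr_left fun u => ?_
  simp only [taylorWithinEval_succ, taylor_within_zero_eval, iteratedDerivWithin_univ,
    zero_add, iteratedDeriv_one, h0, h1, smul_eq_mul]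
  norm_num
  ring

/-- A function with second-order coefficient `c` at `1` satisfies
`f (1 + t g) / t² → c g²` as `t → 0⁺`. -/
theorem tendsto_rescaled_of_isLittleO {f : ℝ → ℝ} {c : ℝ}
    (h : (fun u => f u - c * (u - 1) ^ 2) =o[nhds 1] fun u => (u - 1) ^ 2) (g : ℝ) :
    Tendsto (fun t : ℝ => 1 / t ^ 2 * f (1 + t * g)) (nhdsWithin 0 (Set.Ioi 0))
      (nhds (c * g ^ 2)) := by
  have hu : Tendsto (fun t : ℝ => 1 + t * g) (nhdsWithin 0 (Set.Ioi 0)) (nhds 1) := by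
    have : Continuous fun t : ℝ => 1 + t * g := by fun_prop
    simpa using (this.tendsto 0).mono_left nhdsWithin_le_nhds
  have hO : (fun t : ℝ => (1 + t * g - 1) ^ 2) =O[nhdsWithin 0 (Set.Ioi 0)]
      fun t : ℝ => t ^ 2 :=
    Asymptotics.IsBigO.of_bound (g ^ 2) (Eventually.of_forall fun t => by
      simp only [Real.norm_eq_abs, abs_pow, sq_abs]
      exact le_of_eq (by ring))
  have hlim := ((h.comp_tendsto hu).trans_isBigO hO).tendsto_div_nhds_zero.add_const (c * g ^ 2)
  rw [zero_add] at hlim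
  refine hlim.congr' ?_
  filter_upwards [self_mem_nhdsWithin] with t ht
  have ht' : t ≠ 0 := ne_of_gt ht
  simp only [Function.comp_apply]
  field_simp
  ring

/-- If `f = c (u - 1)² + o((u - 1)²)` at `1`, then `f (1 + t g) / t²` is bounded by
`(|c| + 1) g²` for small `t > 0`, uniformly over bounded `g`. -/
theorem eventually_abs_rescaled_le_of_isLittleO {f : ℝ → ℝ} {c : ℝ}
    (h : (fun u => f u - c * (u - 1) ^ 2) =o[nhds 1] fun u => (u - 1) ^ 2) (M : ℝ) :
    ∀ᶠ t : ℝ in nhdsWithin 0 (Set.Ioi 0), ∀ g : ℝ, |g| ≤ M →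
      |1 / t ^ 2 * f (1 + t * g)| ≤ (|c| + 1) * g ^ 2 := by
  obtain ⟨δ, hδ, hball⟩ := Metric.eventually_nhds_iff.1 (h.def one_pos)
  have hsmall : ∀ᶠ t : ℝ in nhdsWithin 0 (Set.Ioi 0), t * M < δ := by
    have hc : Continuous fun t : ℝ => t * M := by fun_prop
    have : Tendsto (fun t : ℝ => t * M) (nhdsWithin 0 (Set.Ioi 0)) (nhds 0) := by
      simpa using (hc.tendsto 0).mono_left nhdsWithin_le_nhds
    exact this.eventually_lt_const hδ
  filter_upwards [hsmall, self_mem_nhdsWithin] with t htM ht g hg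
  have ht0 : 0 < t := ht
  have hdist : dist (1 + t * g) 1 < δ := by
    rw [Real.dist_eq, add_sub_cancel_left, abs_mul, abs_of_pos ht0]
    exact (mul_le_mul_of_nonneg_left hg ht0.le).trans_lt htM
  have hb := hball hdist
  simp only [Real.norm_eq_abs, abs_pow, sq_abs, one_mul, add_sub_cancel_left] at hb
  have hf : |f (1 + t * g)| ≤ (|c| + 1) * g ^ 2 * t ^ 2 := by
    have h1 := abs_add_le (f (1 + t * g) - c * (t * g) ^ 2) (c * (t * g) ^ 2)
    rw [sub_add_cancel, abs_mul c, abs_of_nonneg (sq_nonneg (t * g))] at h1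
    nlinarith
  rw [abs_mul, abs_of_nonneg (by positivity : 0 ≤ 1 / t ^ 2), one_div_mul_eq_div]
  exact (div_le_iff₀ (by positivity)).2 hf

/-- Local behavior of the transport f-divergence along the
Wasserstein-2 geodesic `p_λ = ((1−λ)·id + λ·T)_# q`:
`lim_{λ→0} λ⁻² D_{T,f}(p_λ‖q) = (f''(1)/2) ∫ |T'(x) − 1|² q(x) dx`. -/
theorem transport_f_divergence_local_behavior
    (p q : ℝ → ℝ)
    (hp_pos : ∀ x, 0 < p x) (hq_pos : ∀ x, 0 < q x)
    (hp_smooth : ContDiff ℝ (⊤ : ℕ∞) p) (hq_smooth : ContDiff ℝ (⊤ : ℕ∞) q)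
    (hp_prob : ∫ x, p x = 1) (hq_prob : ∫ x, q x = 1)
    (T : ℝ → ℝ)
    (hT_mono : StrictMono T) (hT_smooth : ContDiff ℝ (⊤ : ℕ∞) T)
    (hT_push : ∀ x, p (T x) * deriv T x = q x)
    (plam : ℝ → ℝ → ℝ)
    (hplam_push : ∀ lam ∈ Set.Icc (0 : ℝ) 1, ∀ x,
      plam lam ((1 - lam) * x + lam * T x)
        * deriv (fun y => (1 - lam) * y + lam * T y) x = q x)
    (f : ℝ → ℝ)
    (hf_smooth : ContDiff ℝ 2 f)
    (hf_conv : ConvexOn ℝ Set.univ f)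
    (hf_nonneg : ∀ u, 0 ≤ f u)
    (hf_one : f 1 = 0) (hf_one' : deriv f 1 = 0)
    (hT_bdd : ∃ M : ℝ, ∀ x, |deriv T x - 1| ≤ M)
    (hint : Integrable (fun x => |deriv T x - 1| ^ 2 * q x)) :
    Tendsto
      (fun lam : ℝ => (1 / lam ^ 2) *
        ∫ x, f (deriv (fun y => (1 - lam) * y + lam * T y) x) * q x)
      (nhdsWithin 0 (Set.Ioi 0))
      (nhds ((iteratedDeriv 2 f 1 / 2) * ∫ x, |deriv T x - 1| ^ 2 * q x)) := by
  obtain ⟨M, hM⟩ := hT_bdd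
  have hT_diff : Differentiable ℝ T := hT_smooth.differentiable (by simp)
  have hT'_cont : Continuous (deriv T) := hT_smooth.continuous_deriv (by simp)
  have hderiv : ∀ lam x : ℝ, deriv (fun y => (1 - lam) * y + lam * T y) x
      = 1 + lam * (deriv T x - 1) := fun lam x => by
    have := (((hasDerivAt_id x).const_mul (1 - lam)).add
      ((hT_diff x).hasDerivAt.const_mul lam)).deriv
    refine this.trans ?_
    ring
  have ho := isLittleO_sub_half_iteratedDeriv_two hf_smooth hf_one hf_one'
  simp only [hderiv, ← integral_const_mul]
  refine tendsto_integral_filter_of_dominated_convergence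
    (fun x => (|iteratedDeriv 2 f 1 / 2| + 1) * (|deriv T x - 1| ^ 2 * q x)) ?_ ?_
    (hint.const_mul _) ?_
  · refine Eventually.of_forall fun lam => Continuous.aestronglyMeasurable ?_
    have hf_cont := hf_smooth.continuous
    have hq_cont := hq_smooth.continuous
    fun_prop
  · filter_upwards [eventually_abs_rescaled_le_of_isLittleO ho M] with lam hlam
    refine Eventually.of_forall fun x => ?_
    rw [← mul_assoc, ← mul_assoc, Real.norm_eq_abs, abs_mul, abs_of_pos (hq_pos x), sq_abs]
    exact mul_le_mul_of_nonneg_right (hlam _ (hM x)) (hq_pos x).le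
  · refine Eventually.of_forall fun x => ?_
    simpa only [sq_abs, mul_assoc] using
      (tendsto_rescaled_of_isLittleO ho (deriv T x - 1)).mul_const (q x)
end

section
/- Let p, q be smooth positive probability densities on ℝ with quantile functions Q_p, Q_q and let T be the monotone map with T_#q = p. Then for f(u) = u − log u − 1 (u > 0), the transport KL divergence satisfies D_{TKL}(p‖q) = ∫_ℝ ( T'(x) − log T'(x) − 1 ) q(x) dx = ∫_0^1 ( Q_p'(u)/Q_q'(u) − log( Q_p'(u)/Q_q'(u) ) − 1 ) du. -/
open MeasureTheory

/-- The distribution function of a continuous integrable density is strictly differentiable, with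
derivative the density. -/
theorem hasStrictDerivAt_of_eq_setIntegral_Iio {p F : ℝ → ℝ} (hp : Continuous p)
    (hint : Integrable p) (hF : ∀ x, F x = ∫ y in Set.Iio x, p y) (x : ℝ) :
    HasStrictDerivAt F (p x) x := by
  have key : F = fun x => (∫ y in Set.Iic (0 : ℝ), p y) + ∫ y in (0 : ℝ)..x, p y := by
    funext z
    rw [hF, ← integral_Iic_eq_integral_Iio,
      ← intervalIntegral.integral_Iic_sub_Iic hint.integrableOn hint.integrableOn]
    ring
  rw [key]
  exact (hp.integral_hasStrictDerivAt 0 x).const_add _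

/-- The distribution function of a positive probability density takes values in `(0, 1)`. -/
theorem mem_Ioo_of_eq_setIntegral_Iio {p F : ℝ → ℝ} (hpos : ∀ x, 0 < p x)
    (hint : Integrable p) (hprob : ∫ x, p x = 1)
    (hF : ∀ x, F x = ∫ y in Set.Iio x, p y) (x : ℝ) : F x ∈ Set.Ioo (0 : ℝ) 1 := by
  have hsupp : Function.support p = Set.univ :=
    Set.eq_univ_of_forall fun y => (hpos y).ne'
  have pos_of : ∀ s : Set ℝ, MeasurableSet s → 0 < volume s → 0 < ∫ y in s, p y := by
    intro s hs hvol
    rw [setIntegral_pos_iff_support_of_nonneg_ae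
      (Filter.Eventually.of_forall fun y => (hpos y).le) hint.integrableOn, hsupp, Set.univ_inter]
    exact hvol
  have hsum := integral_add_compl (measurableSet_Iio (a := x)) hint
  have h0 := pos_of (Set.Iio x) measurableSet_Iio (by simp)
  have h1 := pos_of (Set.Iio x)ᶜ measurableSet_Iio.compl (by simp)
  rw [hF]
  exact ⟨h0, by linarith⟩

/-- Two functions onto `(0, 1)` whose difference is constant are equal. -/
theorem eq_zero_of_range_Ioo {α : Type*} {G F : α → ℝ} {c : ℝ}
    (hG : ∀ x, G x ∈ Set.Ioo (0 : ℝ) 1) (hF : ∀ u ∈ Set.Ioo (0 : ℝ) 1, ∃ x, F x = u)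
    (hc : ∀ x, G x = F x + c) : c = 0 := by
  rcases lt_trichotomy c 0 with h | h | h
  · obtain ⟨x, hx⟩ := hF (min (1 / 2) (-c))
      ⟨lt_min (by norm_num) (by linarith), (min_le_left _ _).trans_lt (by norm_num)⟩
    have := (hG x).1
    have := min_le_right (1 / 2) (-c)
    linarith [hc x]
  · exact h
  · obtain ⟨x, hx⟩ := hF (max (1 / 2) (1 - c))
      ⟨lt_max_of_lt_left (by norm_num), max_lt (by norm_num) (by linarith)⟩
    have := (hG x).2
    have := le_max_right (1 / 2) (1 - c)
    linarith [hc x]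

/-- Transport KL divergence (`f(u) = u − log u − 1`):
`D_TKL(p‖q) = ∫ (T'(x) − log T'(x) − 1) q(x) dx
            = ∫_0^1 (Q_p'(u)/Q_q'(u) − log(Q_p'(u)/Q_q'(u)) − 1) du`. -/
theorem transport_KL_divergence_formulas
    (p q : ℝ → ℝ)
    (hp_pos : ∀ x, 0 < p x) (hq_pos : ∀ x, 0 < q x)
    (hp_smooth : ContDiff ℝ (⊤ : ℕ∞) p) (hq_smooth : ContDiff ℝ (⊤ : ℕ∞) q)
    (hp_prob : ∫ x, p x = 1) (hq_prob : ∫ x, q x = 1)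
    (Fp Fq Qp Qq : ℝ → ℝ)
    (hFp : ∀ x, Fp x = ∫ y in Set.Iio x, p y)
    (hFq : ∀ x, Fq x = ∫ y in Set.Iio x, q y)
    (hQp_left : ∀ x, Qp (Fp x) = x)
    (hQp_right : ∀ u ∈ Set.Ioo (0 : ℝ) 1, Fp (Qp u) = u)
    (hQq_left : ∀ x, Qq (Fq x) = x)
    (hQq_right : ∀ u ∈ Set.Ioo (0 : ℝ) 1, Fq (Qq u) = u)
    (T : ℝ → ℝ)
    (hT_mono : StrictMono T) (hT_diff : Differentiable ℝ T)
    (hT_surj : Function.Surjective T)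
    (hT_push : ∀ x, p (T x) * deriv T x = q x) :
    ∫ x, (deriv T x - Real.log (deriv T x) - 1) * q x
      = ∫ u in Set.Ioo (0 : ℝ) 1,
          (deriv Qp u / deriv Qq u - Real.log (deriv Qp u / deriv Qq u) - 1) := by
  have hp_int : Integrable p := by
    by_contra h
    simp [integral_undef h] at hp_prob
  have hq_int : Integrable q := by
    by_contra h
    simp [integral_undef h] at hq_prob
  have dFp := hasStrictDerivAt_of_eq_setIntegral_Iio hp_smooth.continuous hp_int hFp
  have dFq := hasStrictDerivAt_of_eq_setIntegral_Iio hq_smooth.continuous hq_int hFq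
  have mFp := mem_Ioo_of_eq_setIntegral_Iio hp_pos hp_int hp_prob hFp
  have mFq := mem_Ioo_of_eq_setIntegral_Iio hq_pos hq_int hq_prob hFq
  have hconst : ∀ x, Fp (T x) - Fq x = Fp (T 0) - Fq 0 := by
    have hd : ∀ x, HasDerivAt (fun x => Fp (T x) - Fq x) 0 x := fun x => by
      have h := ((dFp (T x)).hasDerivAt.comp x (hT_diff x).hasDerivAt).sub (dFq x).hasDerivAt
      rwa [hT_push, sub_self] at h
    exact fun x => is_const_of_deriv_eq_zero (fun y => (hd y).differentiableAt)
      (fun y => (hd y).deriv) x 0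
  have hc : Fp (T 0) - Fq 0 = 0 :=
    eq_zero_of_range_Ioo (G := fun x => Fp (T x)) (F := Fq) (fun x => mFp (T x))
      (fun u hu => ⟨Qq u, hQq_right u hu⟩) (fun x => by linarith [hconst x])
  have hFT : ∀ x, Fp (T x) = Fq x := fun x => by linarith [hconst x]
  have dQp : ∀ x, deriv Qp (Fq x) = (p (T x))⁻¹ := fun x => by
    rw [← hFT]
    exact ((dFp (T x)).to_local_left_inverse (hp_pos _).ne'
      (Filter.Eventually.of_forall hQp_left)).hasDerivAt.deriv
  have dQq : ∀ x, deriv Qq (Fq x) = (q x)⁻¹ := fun x =>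
    ((dFq x).to_local_left_inverse (hq_pos _).ne'
      (Filter.Eventually.of_forall hQq_left)).hasDerivAt.deriv
  have hratio : ∀ x, deriv Qp (Fq x) / deriv Qq (Fq x) = deriv T x := fun x => by
    rw [dQp, dQq, ← hT_push x]
    have := (hp_pos (T x)).ne'
    field_simp
  have himage : Fq '' Set.univ = Set.Ioo 0 1 := by
    rw [Set.image_univ]
    exact Set.Subset.antisymm (Set.range_subset_iff.2 mFq) fun u hu => ⟨Qq u, hQq_right u hu⟩
  rw [← himage, integral_image_eq_integral_abs_deriv_smul MeasurableSet.univ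
    (fun x _ => (dFq x).hasDerivAt.hasDerivWithinAt)
    (Function.LeftInverse.injective hQq_left).injOn, setIntegral_univ]
  refine integral_congr_ae (Filter.Eventually.of_forall fun x => ?_)
  simp only [hratio, abs_of_pos (hq_pos x), smul_eq_mul]
  ring
end
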